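/- arXiv:1812.03439 — 2 statements merged into one kernel-verified Lean document; each statement's English description precedes it below -/
import Mathlib

section
/- Let H be a quasi-Hopf algebra over a field k with bijective antipode S (inverse S̄), μ : H → k an algebra map, f the Drinfeld twist of H, U^L = f̄1S(q^R_2) ⊗ f̄2S(q^R_1), and W^L = μ(φ̄1)·f̄1S(q^R_2 φ̄3) ⊗ f̄2S((q^R_1 ↼ μ)φ̄2), where h ↼ μ = μ(h_(1))h_(2). Then W^L = μ(φ1)·S(φ2)_(1) U^L_1 φ3 ⊗ S(φ2)_(2) U^L_2 and U^L = μ(φ̄1)·S(φ̄2)_(1) W^L_1 φ̄3 ⊗ S(φ̄2)_(2) W^L_2. -/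
open scoped TensorProduct

noncomputable section

/-- A quasi-Hopf algebra over a field `k`, presented together with explicit
(Sweedler-style) finite representations of the comultiplication and of the
associator `φ` and its inverse `φ⁻¹`.  The fields `n, d1, d2` give, for every
`h : H`, a finite family with `Δ h = ∑ i < n h, d1 h i ⊗ d2 h i`; similarly
`P1, P2, P3` (resp. `Q1, Q2, Q3`) are the components of `φ` (resp. `φ⁻¹`). -/
structure QuasiHopf (k H : Type) [Field k] [Ring H] [Algebra k H] where
  comul : H →ₐ[k] H ⊗[k] H
  counit : H →ₐ[k] k
  n : H → ℕ
  d1 : H → ℕ → H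
  d2 : H → ℕ → H
  comul_eq : ∀ h, comul h = ∑ i ∈ Finset.range (n h), d1 h i ⊗ₜ[k] d2 h i
  np : ℕ
  P1 : ℕ → H
  P2 : ℕ → H
  P3 : ℕ → H
  nq : ℕ
  Q1 : ℕ → H
  Q2 : ℕ → H
  Q3 : ℕ → H
  S : H →ₗ[k] H
  Sinv : H →ₗ[k] H
  alpha : H
  beta : H
  S_one : S 1 = 1
  S_mul : ∀ x y : H, S (x * y) = S y * S x
  Sinv_S : ∀ x : H, Sinv (S x) = x
  S_Sinv : ∀ x : H, S (Sinv x) = x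
  phi_phiInv :
    (∑ a ∈ Finset.range np, P1 a ⊗ₜ[k] (P2 a ⊗ₜ[k] P3 a)) *
      (∑ b ∈ Finset.range nq, Q1 b ⊗ₜ[k] (Q2 b ⊗ₜ[k] Q3 b)) = 1
  phiInv_phi :
    (∑ b ∈ Finset.range nq, Q1 b ⊗ₜ[k] (Q2 b ⊗ₜ[k] Q3 b)) *
      (∑ a ∈ Finset.range np, P1 a ⊗ₜ[k] (P2 a ⊗ₜ[k] P3 a)) = 1
  qcoassoc : ∀ h : H,
    ∑ i ∈ Finset.range (n h), d1 h i ⊗ₜ[k] comul (d2 h i) =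
      (∑ a ∈ Finset.range np, P1 a ⊗ₜ[k] (P2 a ⊗ₜ[k] P3 a)) *
        (∑ i ∈ Finset.range (n h), ∑ j ∈ Finset.range (n (d1 h i)),
          d1 (d1 h i) j ⊗ₜ[k] (d2 (d1 h i) j ⊗ₜ[k] d2 h i)) *
        (∑ b ∈ Finset.range nq, Q1 b ⊗ₜ[k] (Q2 b ⊗ₜ[k] Q3 b))
  counit_left : ∀ h : H, ∑ i ∈ Finset.range (n h), counit (d1 h i) • d2 h i = h
  counit_right : ∀ h : H, ∑ i ∈ Finset.range (n h), counit (d2 h i) • d1 h i = h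
  pentagon :
    (∑ a ∈ Finset.range np, P1 a ⊗ₜ[k] (P2 a ⊗ₜ[k] comul (P3 a))) *
      (∑ a ∈ Finset.range np, ∑ i ∈ Finset.range (n (P1 a)),
        d1 (P1 a) i ⊗ₜ[k] (d2 (P1 a) i ⊗ₜ[k] (P2 a ⊗ₜ[k] P3 a))) =
    ((1 : H) ⊗ₜ[k] (∑ a ∈ Finset.range np, P1 a ⊗ₜ[k] (P2 a ⊗ₜ[k] P3 a))) *
      (∑ a ∈ Finset.range np, ∑ i ∈ Finset.range (n (P2 a)),
        P1 a ⊗ₜ[k] (d1 (P2 a) i ⊗ₜ[k] (d2 (P2 a) i ⊗ₜ[k] P3 a))) *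
      (∑ a ∈ Finset.range np, P1 a ⊗ₜ[k] (P2 a ⊗ₜ[k] (P3 a ⊗ₜ[k] (1 : H))))
  counit_mid_phi :
    ∑ a ∈ Finset.range np, counit (P2 a) • (P1 a ⊗ₜ[k] P3 a) = (1 : H) ⊗ₜ[k] (1 : H)
  antipode_alpha : ∀ h : H,
    ∑ i ∈ Finset.range (n h), S (d1 h i) * alpha * d2 h i = counit h • alpha
  antipode_beta : ∀ h : H,
    ∑ i ∈ Finset.range (n h), d1 h i * beta * S (d2 h i) = counit h • beta
  nondeg_1 : ∑ a ∈ Finset.range np, P1 a * beta * S (P2 a) * alpha * P3 a = 1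
  nondeg_2 : ∑ b ∈ Finset.range nq, S (Q1 b) * alpha * Q2 b * beta * S (Q3 b) = 1
  counit_alpha : counit alpha = 1
  counit_beta : counit beta = 1

namespace QuasiHopf

variable {k H : Type} [Field k] [Ring H] [Algebra k H] (q : QuasiHopf k H)

/-- The associator `φ` as an element of `H ⊗ H ⊗ H`. -/
def Phi : H ⊗[k] (H ⊗[k] H) :=
  ∑ a ∈ Finset.range q.np, q.P1 a ⊗ₜ[k] (q.P2 a ⊗ₜ[k] q.P3 a)

/-- `φ⁻¹` as an element of `H ⊗ H ⊗ H`. -/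
def PhiInv : H ⊗[k] (H ⊗[k] H) :=
  ∑ b ∈ Finset.range q.nq, q.Q1 b ⊗ₜ[k] (q.Q2 b ⊗ₜ[k] q.Q3 b)

/-- first components of `p^R = φ̄1 ⊗ φ̄2 β S(φ̄3)` -/
def pR1 (b : ℕ) : H := q.Q1 b

def pR2 (b : ℕ) : H := q.Q2 b * q.beta * q.S (q.Q3 b)

def pRE : H ⊗[k] H := ∑ b ∈ Finset.range q.nq, q.pR1 b ⊗ₜ[k] q.pR2 b

/-- components of `q^R = φ1 ⊗ S̄(α φ3) φ2` -/
def qR1 (a : ℕ) : H := q.P1 a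

def qR2 (a : ℕ) : H := q.Sinv (q.alpha * q.P3 a) * q.P2 a

def qRE : H ⊗[k] H := ∑ a ∈ Finset.range q.np, q.qR1 a ⊗ₜ[k] q.qR2 a

/-- components of `p^L = φ2 S̄(φ1 β) ⊗ φ3` -/
def pL1 (a : ℕ) : H := q.P2 a * q.Sinv (q.P1 a * q.beta)

def pL2 (a : ℕ) : H := q.P3 a

def pLE : H ⊗[k] H := ∑ a ∈ Finset.range q.np, q.pL1 a ⊗ₜ[k] q.pL2 a

/-- components of `q^L = S(φ̄1) α φ̄2 ⊗ φ̄3` -/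
def qL1 (b : ℕ) : H := q.S (q.Q1 b) * q.alpha * q.Q2 b

def qL2 (b : ℕ) : H := q.Q3 b

def qLE : H ⊗[k] H := ∑ b ∈ Finset.range q.nq, q.qL1 b ⊗ₜ[k] q.qL2 b

/-- `𝕒 = S(φ̄1 φ2) α φ̄2 φ3₍₁₎ ⊗ S(φ1) α φ̄3 φ3₍₂₎` -/
def aEl : H ⊗[k] H :=
  ∑ a ∈ Finset.range q.np, ∑ b ∈ Finset.range q.nq, ∑ m ∈ Finset.range (q.n (q.P3 a)),
    (q.S (q.Q1 b * q.P2 a) * q.alpha * q.Q2 b * q.d1 (q.P3 a) m) ⊗ₜ[k]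
      (q.S (q.P1 a) * q.alpha * q.Q3 b * q.d2 (q.P3 a) m)

/-- `𝕓 = φ1₍₁₎ φ̄1 β S(φ3) ⊗ φ1₍₂₎ φ̄2 β S(φ2 φ̄3)` -/
def bEl : H ⊗[k] H :=
  ∑ a ∈ Finset.range q.np, ∑ b ∈ Finset.range q.nq, ∑ m ∈ Finset.range (q.n (q.P1 a)),
    (q.d1 (q.P1 a) m * q.Q1 b * q.beta * q.S (q.P3 a)) ⊗ₜ[k]
      (q.d2 (q.P1 a) m * q.Q2 b * q.beta * q.S (q.P2 a * q.Q3 b))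

/-- `(S ⊗ S)(Δ^cop x) = S(x₍₂₎) ⊗ S(x₍₁₎)` -/
def scop (x : H) : H ⊗[k] H :=
  ∑ m ∈ Finset.range (q.n x), q.S (q.d2 x m) ⊗ₜ[k] q.S (q.d1 x m)

/-- The Drinfeld twist `f = (S⊗S)(Δ^cop(p^R_1)) · 𝕒 · Δ(p^R_2)`. -/
def twist : H ⊗[k] H :=
  ∑ b ∈ Finset.range q.nq, q.scop (q.pR1 b) * q.aEl * q.comul (q.pR2 b)

/-- `f⁻¹ = Δ(q^L_1) · 𝕓 · (S⊗S)(Δ^cop(q^L_2))`. -/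
def twistInv : H ⊗[k] H :=
  ∑ b ∈ Finset.range q.nq, q.comul (q.qL1 b) * q.bEl * q.scop (q.qL2 b)

/-- `x ⊗ y ↦ S y ⊗ S x` -/
def sswap : H ⊗[k] H →ₗ[k] H ⊗[k] H :=
  (TensorProduct.map q.S q.S).comp (TensorProduct.comm k H H).toLinearMap

/-- `x ⊗ y ↦ S̄ y ⊗ S̄ x` -/
def sswapInv : H ⊗[k] H →ₗ[k] H ⊗[k] H :=
  (TensorProduct.map q.Sinv q.Sinv).comp (TensorProduct.comm k H H).toLinearMap

/-- `U^L = f̄1 S(q^R_2) ⊗ f̄2 S(q^R_1)` -/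
def UL : H ⊗[k] H := q.twistInv * q.sswap q.qRE

/-- `V^L = S̄(f2 p^R_2) ⊗ S̄(f1 p^R_1)` -/
def VL : H ⊗[k] H := q.sswapInv (q.twist * q.pRE)

/-- `U^R = S̄(q^L_2 f̄2) ⊗ S̄(q^L_1 f̄1)` -/
def UR : H ⊗[k] H := q.sswapInv (q.qLE * q.twistInv)

/-- `V^R = S(p^L_2) f1 ⊗ S(p^L_1) f2` -/
def VR : H ⊗[k] H := q.sswap q.pLE * q.twist

/-- `h ↦ h ↼ μ = μ(h₍₁₎) h₍₂₎` -/
def lhook (mu : H →ₐ[k] k) : H →ₗ[k] H :=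
  (TensorProduct.lid k H).toLinearMap.comp
    ((TensorProduct.map mu.toLinearMap LinearMap.id).comp q.comul.toLinearMap)

/-- `h ↦ μ ⇀ h = μ(h₍₂₎) h₍₁₎` -/
def rhook (mu : H →ₐ[k] k) : H →ₗ[k] H :=
  (TensorProduct.rid k H).toLinearMap.comp
    ((TensorProduct.map LinearMap.id mu.toLinearMap).comp q.comul.toLinearMap)

/-- `W^L = μ(φ̄1) f̄1 S(q^R_2 φ̄3) ⊗ f̄2 S((q^R_1 ↼ μ) φ̄2)` -/
def WL (mu : H →ₐ[k] k) : H ⊗[k] H :=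
  q.twistInv * q.sswap ((TensorProduct.map (q.lhook mu) LinearMap.id q.qRE) *
    (∑ b ∈ Finset.range q.nq, mu (q.Q1 b) • (q.Q2 b ⊗ₜ[k] q.Q3 b)))

/-- `W^R = μ(φ3) S̄((μ ⇀ q^L_2) φ2 f̄2) ⊗ S̄(q^L_1 φ1 f̄1)` -/
def WR (mu : H →ₐ[k] k) : H ⊗[k] H :=
  q.sswapInv ((TensorProduct.map LinearMap.id (q.rhook mu) q.qLE) *
    (∑ a ∈ Finset.range q.np, mu (q.P3 a) • (q.P1 a ⊗ₜ[k] q.P2 a)) * q.twistInv)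

section Modules

variable {V W X : Type} [AddCommGroup V] [Module k V] [AddCommGroup W] [Module k W]
  [AddCommGroup X] [Module k X]

/-- The tensor-product action `h · (v ⊗ w) = h₍₁₎ v ⊗ h₍₂₎ w`. -/
def tensAct (ρV : H → Module.End k V) (ρW : H → Module.End k W) (h : H) :
    Module.End k (V ⊗[k] W) :=
  ∑ i ∈ Finset.range (q.n h), TensorProduct.map (ρV (q.d1 h i)) (ρW (q.d2 h i))

/-- The action on the left dual: `(h · ξ)(x) = ξ(S(h) x)`. -/
def dualAct (ρX : H → Module.End k X) (h : H) : Module.End k (Module.Dual k X) :=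
  LinearMap.dualMap (ρX (q.S h))

end Modules

end QuasiHopf

/-- `f` intertwines the two given `H`-actions. -/
def IsHLin {k H V W : Type} [Field k] [Ring H] [Algebra k H]
    [AddCommGroup V] [Module k V] [AddCommGroup W] [Module k W]
    (ρV : H → Module.End k V) (ρW : H → Module.End k W) (f : V →ₗ[k] W) : Prop :=
  ∀ (h : H) (v : V), f (ρV h v) = ρW h (f v)

/-- `x ⊗ y ↦ λ(y) • x` -/
def hitR {k H : Type} [Field k] [Ring H] [Algebra k H] (lam : H →ₗ[k] k) :
    H ⊗[k] H →ₗ[k] H :=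
  (TensorProduct.rid k H).toLinearMap.comp (TensorProduct.map LinearMap.id lam)

/-- `x ⊗ y ↦ λ(x) • y` -/
def hitL {k H : Type} [Field k] [Ring H] [Algebra k H] (lam : H →ₗ[k] k) :
    H ⊗[k] H →ₗ[k] H :=
  (TensorProduct.lid k H).toLinearMap.comp (TensorProduct.map lam LinearMap.id)

namespace QuasiHopf

variable {k H : Type} [Field k] [Ring H] [Algebra k H] (q : QuasiHopf k H)

/-! Instance shortcuts: without them, distributivity on `H^{⊗4}` is not found by unification. -/

local instance tensorFourNonAssocSemiring :
    NonAssocSemiring (H ⊗[k] (H ⊗[k] (H ⊗[k] H))) :=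
  (Algebra.TensorProduct.instSemiring :
    Semiring (H ⊗[k] (H ⊗[k] (H ⊗[k] H)))).toNonAssocSemiring

local instance tensorFourSemiring : NonUnitalNonAssocSemiring (H ⊗[k] (H ⊗[k] (H ⊗[k] H))) :=
  tensorFourNonAssocSemiring.toNonUnitalNonAssocSemiring

local instance tensorFourOne : One (H ⊗[k] (H ⊗[k] (H ⊗[k] H))) :=
  tensorFourNonAssocSemiring.toOne

local instance tensorFourMul : Mul (H ⊗[k] (H ⊗[k] (H ⊗[k] H))) := tensorFourSemiring.toMul

local instance tensorFourDistrib : Distrib (H ⊗[k] (H ⊗[k] (H ⊗[k] H))) :=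
  tensorFourSemiring.toDistrib

/-- `Δ ⊗ id : H ⊗ H → H ⊗ H ⊗ H`, re-associated to the right. -/
def comulLeft : H ⊗[k] H →ₐ[k] H ⊗[k] (H ⊗[k] H) :=
  (Algebra.TensorProduct.assoc k k k H H H).toAlgHom.comp
    (Algebra.TensorProduct.map q.comul (AlgHom.id k H))

/-- `id ⊗ Δ : H ⊗ H → H ⊗ H ⊗ H`. -/
def comulRight : H ⊗[k] H →ₐ[k] H ⊗[k] (H ⊗[k] H) :=
  Algebra.TensorProduct.map (AlgHom.id k H) q.comul

/-- `Δ ⊗ id ⊗ id : H^{⊗3} → H^{⊗4}`. -/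
def comulFst : H ⊗[k] (H ⊗[k] H) →ₐ[k] H ⊗[k] (H ⊗[k] (H ⊗[k] H)) :=
  (Algebra.TensorProduct.assoc k k k H H (H ⊗[k] H)).toAlgHom.comp
    (Algebra.TensorProduct.map q.comul (AlgHom.id k (H ⊗[k] H)))

/-- `id ⊗ Δ ⊗ id : H^{⊗3} → H^{⊗4}`. -/
def comulSnd : H ⊗[k] (H ⊗[k] H) →ₐ[k] H ⊗[k] (H ⊗[k] (H ⊗[k] H)) :=
  Algebra.TensorProduct.map (AlgHom.id k H) q.comulLeft

/-- `id ⊗ id ⊗ Δ : H^{⊗3} → H^{⊗4}`. -/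
def comulTrd : H ⊗[k] (H ⊗[k] H) →ₐ[k] H ⊗[k] (H ⊗[k] (H ⊗[k] H)) :=
  Algebra.TensorProduct.map (AlgHom.id k H) q.comulRight

/-- `(x ⊗ y ⊗ z) ⊗ w ↦ x ⊗ y ⊗ z ⊗ w`. -/
def append : (H ⊗[k] (H ⊗[k] H)) ⊗[k] H →ₐ[k] H ⊗[k] (H ⊗[k] (H ⊗[k] H)) :=
  (Algebra.TensorProduct.map (AlgHom.id k H)
    (Algebra.TensorProduct.assoc k k k H H H).toAlgHom).comp
      (Algebra.TensorProduct.assoc k k k H (H ⊗[k] H) H).toAlgHom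

@[simp] lemma append_tmul (x y z w : H) :
    append (k := k) ((x ⊗ₜ (y ⊗ₜ z)) ⊗ₜ w) = x ⊗ₜ (y ⊗ₜ (z ⊗ₜ w)) := rfl

@[simp] lemma comulRight_tmul (x y : H) : q.comulRight (x ⊗ₜ y) = x ⊗ₜ q.comul y := rfl

@[simp] lemma comulLeft_tmul (x y : H) :
    q.comulLeft (x ⊗ₜ y) = Algebra.TensorProduct.assoc k k k H H H (q.comul x ⊗ₜ y) := rfl

@[simp] lemma comulFst_tmul (x : H) (t : H ⊗[k] H) :
    q.comulFst (x ⊗ₜ t) =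
      Algebra.TensorProduct.assoc k k k H H (H ⊗[k] H) (q.comul x ⊗ₜ t) := rfl

@[simp] lemma comulSnd_tmul (x : H) (t : H ⊗[k] H) :
    q.comulSnd (x ⊗ₜ t) = x ⊗ₜ q.comulLeft t := rfl

@[simp] lemma comulTrd_tmul (x : H) (t : H ⊗[k] H) :
    q.comulTrd (x ⊗ₜ t) = x ⊗ₜ q.comulRight t := rfl

@[simp] lemma sswap_tmul (x y : H) : q.sswap (x ⊗ₜ y) = q.S y ⊗ₜ q.S x := rfl

lemma Phi_mul_PhiInv : q.Phi * q.PhiInv = 1 := q.phi_phiInv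

lemma PhiInv_mul_Phi : q.PhiInv * q.Phi = 1 := q.phiInv_phi

lemma comulRight_comul_mul_Phi (h : H) :
    q.comulRight (q.comul h) * q.Phi = q.Phi * q.comulLeft (q.comul h) := by
  have e := q.qcoassoc h
  have e1 : q.comulRight (q.comul h) =
      ∑ i ∈ Finset.range (q.n h), q.d1 h i ⊗ₜ[k] q.comul (q.d2 h i) := by
    conv_lhs => rw [q.comul_eq h]
    simp
  have e2 : q.comulLeft (q.comul h) =
      ∑ i ∈ Finset.range (q.n h), ∑ j ∈ Finset.range (q.n (q.d1 h i)),
          q.d1 (q.d1 h i) j ⊗ₜ[k] (q.d2 (q.d1 h i) j ⊗ₜ[k] q.d2 h i) := by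
    conv_lhs => rw [q.comul_eq h]
    simp [q.comul_eq (q.d1 h _), TensorProduct.sum_tmul]
  change _ = q.Phi * _ * q.PhiInv at e
  rw [← e1, ← e2] at e
  rw [e, mul_assoc, PhiInv_mul_Phi, mul_one]

lemma PhiInv_mul_comulRight_comul (h : H) :
    q.PhiInv * q.comulRight (q.comul h) = q.comulLeft (q.comul h) * q.PhiInv := by
  calc q.PhiInv * q.comulRight (q.comul h)
      = q.PhiInv * (q.comulRight (q.comul h) * q.Phi) * q.PhiInv := by
        rw [mul_assoc, mul_assoc, Phi_mul_PhiInv, mul_one]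
    _ = _ := by
        rw [comulRight_comul_mul_Phi, ← mul_assoc, PhiInv_mul_Phi, one_mul]

lemma pentagon_Phi :
    q.comulTrd q.Phi * q.comulFst q.Phi =
      ((1 : H) ⊗ₜ[k] q.Phi) * q.comulSnd q.Phi * append (q.Phi ⊗ₜ (1 : H)) := by
  have e := q.pentagon
  have e1 : q.comulTrd q.Phi =
      ∑ a ∈ Finset.range q.np, q.P1 a ⊗ₜ[k] (q.P2 a ⊗ₜ[k] q.comul (q.P3 a)) := by
    simp [Phi]
  have e2 : q.comulFst q.Phi = ∑ a ∈ Finset.range q.np, ∑ i ∈ Finset.range (q.n (q.P1 a)),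
        q.d1 (q.P1 a) i ⊗ₜ[k] (q.d2 (q.P1 a) i ⊗ₜ[k] (q.P2 a ⊗ₜ[k] q.P3 a)) := by
    simp [Phi, q.comul_eq (q.P1 _), TensorProduct.sum_tmul]
  have e3 : q.comulSnd q.Phi = ∑ a ∈ Finset.range q.np, ∑ i ∈ Finset.range (q.n (q.P2 a)),
        q.P1 a ⊗ₜ[k] (q.d1 (q.P2 a) i ⊗ₜ[k] (q.d2 (q.P2 a) i ⊗ₜ[k] q.P3 a)) := by
    simp [Phi, q.comul_eq (q.P2 _), TensorProduct.sum_tmul, TensorProduct.tmul_sum]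
  have e4 : append (q.Phi ⊗ₜ (1 : H)) =
      ∑ a ∈ Finset.range q.np, q.P1 a ⊗ₜ[k] (q.P2 a ⊗ₜ[k] (q.P3 a ⊗ₜ[k] (1 : H))) := by
    simp [Phi, TensorProduct.sum_tmul]
  rw [e1, e2, e3, e4]
  exact e

/-- `u ⊗ v ↦ S(u) α v`. -/
def mulAlpha : H ⊗[k] H →ₗ[k] H :=
  TensorProduct.lift ((LinearMap.mul k H).comp
    ((LinearMap.mulRight k q.alpha).comp q.S))

/-- `u ⊗ v ↦ u β S(v)`. -/
def mulBeta : H ⊗[k] H →ₗ[k] H :=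
  TensorProduct.lift (((LinearMap.mul k H).comp (LinearMap.mulRight k q.beta)).compl₂ q.S)

@[simp] lemma mulAlpha_tmul (u v : H) : q.mulAlpha (u ⊗ₜ v) = q.S u * q.alpha * v := rfl

@[simp] lemma mulBeta_tmul (u v : H) : q.mulBeta (u ⊗ₜ v) = u * q.beta * q.S v := rfl

lemma mulAlpha_comul (h : H) : q.mulAlpha (q.comul h) = q.counit h • q.alpha := by
  rw [← q.antipode_alpha, q.comul_eq]; simp

lemma mulBeta_comul (h : H) : q.mulBeta (q.comul h) = q.counit h • q.beta := by
  rw [← q.antipode_beta, q.comul_eq]; simp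

lemma sswap_mul (s t : H ⊗[k] H) : q.sswap (s * t) = q.sswap t * q.sswap s := by
  induction s with
  | zero => simp
  | add x y hx hy => simp [add_mul, mul_add, hx, hy]
  | tmul a b =>
    induction t with
    | zero => simp
    | add x y hx hy => simp [add_mul, mul_add, hx, hy]
    | tmul c d => simp [q.S_mul]

lemma scop_eq (x : H) : q.scop x = q.sswap (q.comul x) := by
  rw [q.comul_eq]; simp [scop]

/-- `x₁ ⊗ x₂ ⊗ x₃ ⊗ x₄ ↦ x₁ β S(x₄) ⊗ x₂ β S(x₃)`. -/
def nestBeta : H ⊗[k] (H ⊗[k] (H ⊗[k] H)) →ₗ[k] H ⊗[k] H :=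
  (TensorProduct.map q.mulBeta q.mulBeta).comp
    (((TensorProduct.assoc k H H (H ⊗[k] H)).symm.trans
      (TensorProduct.congr (LinearEquiv.refl k (H ⊗[k] H)) (TensorProduct.comm k H H))).trans
      (TensorProduct.tensorTensorTensorComm k H H H H)).toLinearMap

@[simp] lemma nestBeta_tmul (x y z w : H) : q.nestBeta (x ⊗ₜ (y ⊗ₜ (z ⊗ₜ w))) =
    (x * q.beta * q.S w) ⊗ₜ (y * q.beta * q.S z) := rfl

lemma bEl_eq : q.bEl = q.nestBeta (q.comulFst q.Phi * append (q.PhiInv ⊗ₜ (1 : H))) := by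
  simp only [Phi, PhiInv, TensorProduct.sum_tmul, map_sum, comulFst_tmul, append_tmul,
    Finset.sum_mul, Finset.mul_sum]
  rw [Finset.sum_comm]
  simp [bEl, q.comul_eq (q.P1 _), TensorProduct.sum_tmul, Finset.sum_mul]

lemma tensor4_induction {p : H ⊗[k] (H ⊗[k] (H ⊗[k] H)) → Prop}
    (zero : p 0) (add : ∀ x y, p x → p y → p (x + y))
    (tmul : ∀ a b c d, p (a ⊗ₜ (b ⊗ₜ (c ⊗ₜ d)))) (X) : p X := by
  induction X with
  | zero => exact zero
  | add x y hx hy => exact add _ _ hx hy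
  | tmul a t =>
  induction t with
  | zero => simpa using zero
  | add x y hx hy => rw [TensorProduct.tmul_add]; exact add _ _ hx hy
  | tmul b t =>
  induction t with
  | zero => simpa using zero
  | add x y hx hy =>
    rw [TensorProduct.tmul_add, TensorProduct.tmul_add]; exact add _ _ hx hy
  | tmul c d => exact tmul a b c d

lemma tensor3_induction {p : H ⊗[k] (H ⊗[k] H) → Prop}
    (zero : p 0) (add : ∀ x y, p x → p y → p (x + y))
    (tmul : ∀ a b c, p (a ⊗ₜ (b ⊗ₜ c))) (X) : p X := by
  induction X with
  | zero => exact zero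
  | add x y hx hy => exact add _ _ hx hy
  | tmul a t =>
  induction t with
  | zero => simpa using zero
  | add x y hx hy => rw [TensorProduct.tmul_add]; exact add _ _ hx hy
  | tmul b c => exact tmul a b c

lemma mul_nestBeta_mul_sswap (y z : H ⊗[k] H) (X : H ⊗[k] (H ⊗[k] (H ⊗[k] H))) :
    y * q.nestBeta X * q.sswap z =
      q.nestBeta (Algebra.TensorProduct.assoc k k k H H (H ⊗[k] H) (y ⊗ₜ z) * X) := by
  induction y with
  | zero => simp
  | add a b ha hb => simp [add_mul, TensorProduct.add_tmul, ha, hb]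
  | tmul a b =>
  induction z with
  | zero => simp
  | add a b ha hb => simp [add_mul, mul_add, TensorProduct.tmul_add, ha, hb]
  | tmul c d =>
  induction X using tensor4_induction with
  | zero => simp
  | add a b ha hb => simp only [add_mul, mul_add, map_add, ha, hb]
  | tmul x y z w => simp [q.S_mul, mul_assoc]

lemma nestBeta_mul_comul (X : H ⊗[k] (H ⊗[k] (H ⊗[k] H))) (a c d : H) :
    q.nestBeta (X * append ((a ⊗ₜ q.comul c) ⊗ₜ d)) =
      q.counit c • q.nestBeta (X * (a ⊗ₜ (1 ⊗ₜ (1 ⊗ₜ d)))) := by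
  induction X using tensor4_induction with
  | zero => simp
  | add a b ha hb => simp only [add_mul, map_add, ha, hb, smul_add]
  | tmul x y z w =>
    have key : ∀ t : H ⊗[k] H,
        q.nestBeta (x ⊗ₜ (y ⊗ₜ (z ⊗ₜ w)) * append ((a ⊗ₜ t) ⊗ₜ d)) =
          (x * a * q.beta * q.S (w * d)) ⊗ₜ (y * q.mulBeta t * q.S z) := by
      intro t
      induction t with
      | zero => simp
      | add s t hs ht =>
        simp only [TensorProduct.tmul_add, TensorProduct.add_tmul, map_add, mul_add, add_mul,
          hs, ht]
      | tmul u v => simp [q.S_mul, mul_assoc]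
    rw [key, mulBeta_comul]
    simp

lemma nestBeta_mul_outer (X : H ⊗[k] (H ⊗[k] (H ⊗[k] H))) (h : H) :
    ∑ i ∈ Finset.range (q.n h), q.nestBeta (X * (q.d1 h i ⊗ₜ (1 ⊗ₜ (1 ⊗ₜ q.d2 h i)))) =
      q.counit h • q.nestBeta X := by
  induction X using tensor4_induction with
  | zero => simp
  | add a b ha hb => simp only [add_mul, map_add, Finset.sum_add_distrib, ha, hb, smul_add]
  | tmul x y z w =>
    have e := congrArg (fun t => (x * t * q.S w) ⊗ₜ[k] (y * q.beta * q.S z)) (q.antipode_beta h)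
    simpa [Finset.mul_sum, Finset.sum_mul, TensorProduct.sum_tmul, q.S_mul, mul_assoc,
      TensorProduct.smul_tmul'] using e

lemma comulFst_comulRight (t : H ⊗[k] H) : q.comulFst (q.comulRight t) =
    Algebra.TensorProduct.assoc k k k H H (H ⊗[k] H)
      (Algebra.TensorProduct.map q.comul q.comul t) := by
  induction t with
  | zero => simp
  | add s t hs ht => simp only [map_add, hs, ht]
  | tmul u v => simp

lemma comulFst_comulLeft (u v : H) : q.comulFst (q.comulLeft (u ⊗ₜ v)) =
    append (q.comulLeft (q.comul u) ⊗ₜ v) := by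
  rw [comulLeft_tmul]
  generalize q.comul u = t
  induction t with
  | zero => simp
  | add s t hs ht => simp only [map_add, TensorProduct.add_tmul, hs, ht]
  | tmul a b =>
    simp only [Algebra.TensorProduct.assoc_tmul, comulFst_tmul, comulLeft_tmul]
    generalize q.comul a = t
    induction t with
    | zero => simp
    | add s t hs ht => simp only [map_add, TensorProduct.add_tmul, hs, ht]
    | tmul a b => simp

/-- The map `u ⊗ v ↦ Δ(u) 𝕓 (S ⊗ S)(Δ^cop v)`. -/
def conjB : H ⊗[k] H →ₗ[k] H ⊗[k] H :=
  TensorProduct.lift (((LinearMap.mul k (H ⊗[k] H)).comp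
    ((LinearMap.mulRight k q.bEl).comp q.comul.toLinearMap)).compl₂
      (q.sswap.comp q.comul.toLinearMap))

@[simp] lemma conjB_tmul (u v : H) :
    q.conjB (u ⊗ₜ v) = q.comul u * q.bEl * q.sswap (q.comul v) := rfl

lemma conjB_eq (t : H ⊗[k] H) : q.conjB t =
    q.nestBeta (q.comulFst (q.comulRight t) *
      (q.comulFst q.Phi * append (q.PhiInv ⊗ₜ (1 : H)))) := by
  induction t with
  | zero => simp
  | add s t hs ht => simp only [map_add, add_mul, hs, ht]
  | tmul u v => rw [conjB_tmul, bEl_eq, mul_nestBeta_mul_sswap, comulFst_comulRight]; simp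

lemma comulFst_comulLeft_mul (u v : H) :
    q.comulFst (q.comulLeft (u ⊗ₜ v)) * append (q.PhiInv ⊗ₜ (1 : H)) =
      append (q.PhiInv ⊗ₜ (1 : H)) * append (q.comulRight (q.comul u) ⊗ₜ v) := by
  rw [comulFst_comulLeft, ← map_mul, ← map_mul, Algebra.TensorProduct.tmul_mul_tmul,
    Algebra.TensorProduct.tmul_mul_tmul, PhiInv_mul_comulRight_comul, mul_one, one_mul]

lemma nestBeta_mul_comulRight (X : H ⊗[k] (H ⊗[k] (H ⊗[k] H))) (u v : H) :
    q.nestBeta (X * append (q.comulRight (q.comul u) ⊗ₜ v)) =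
      q.nestBeta (X * (u ⊗ₜ (1 ⊗ₜ (1 ⊗ₜ v)))) := by
  conv_rhs => rw [← q.counit_right u]
  rw [q.comul_eq u]
  simp [TensorProduct.sum_tmul, Finset.mul_sum, nestBeta_mul_comul,
    ← TensorProduct.smul_tmul', mul_smul_comm]

/-- `Δ(h₍₁₎) 𝕓 (S ⊗ S)(Δ^cop h₍₂₎) = ε(h) 𝕓`. -/
lemma conjB_comul (h : H) : q.conjB (q.comul h) = q.counit h • q.bEl := by
  rw [conjB_eq, ← mul_assoc, ← map_mul, comulRight_comul_mul_Phi, map_mul q.comulFst, mul_assoc,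
    q.comul_eq h, bEl_eq, ← nestBeta_mul_outer]
  simp only [map_sum, Finset.sum_mul, Finset.mul_sum]
  refine Finset.sum_congr rfl fun i _ => ?_
  rw [comulFst_comulLeft_mul, ← mul_assoc, nestBeta_mul_comulRight]

/-- The map `x ⊗ y ⊗ z ↦ Δ(S(x) α y) 𝕓 (S ⊗ S)(Δ^cop z)`, sending `φ⁻¹` to `f⁻¹`. -/
def twistMap : H ⊗[k] (H ⊗[k] H) →ₗ[k] H ⊗[k] H :=
  q.conjB.comp ((TensorProduct.map q.mulAlpha LinearMap.id).comp
    (TensorProduct.assoc k H H H).symm.toLinearMap)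

@[simp] lemma twistMap_tmul (x y z : H) : q.twistMap (x ⊗ₜ (y ⊗ₜ z)) =
    q.comul (q.S x * q.alpha * y) * q.bEl * q.sswap (q.comul z) := rfl

lemma twistInv_eq : q.twistInv = q.twistMap q.PhiInv := by
  simp [twistInv, PhiInv, qL1, qL2, scop_eq]

lemma twistMap_comulLeft_mul (X : H ⊗[k] (H ⊗[k] H)) (a c : H) :
    q.twistMap (q.comulLeft (a ⊗ₜ c) * X) =
      q.counit a • (q.twistMap X * q.sswap (q.comul c)) := by
  induction X using tensor3_induction with
  | zero => simp
  | add a b ha hb => simp only [mul_add, add_mul, map_add, ha, hb, smul_add]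
  | tmul x y z =>
    have key : ∀ t : H ⊗[k] H,
        q.twistMap (Algebra.TensorProduct.assoc k k k H H H (t ⊗ₜ c) * x ⊗ₜ (y ⊗ₜ z)) =
          q.comul (q.S x * q.mulAlpha t * y) * q.bEl * q.sswap (q.comul (c * z)) := by
      intro t
      induction t with
      | zero => simp
      | add s t hs ht => simp only [TensorProduct.add_tmul, map_add, mul_add, add_mul, hs, ht]
      | tmul u v => simp [q.S_mul, mul_assoc]
    rw [comulLeft_tmul, key, mulAlpha_comul]
    simp [sswap_mul, mul_assoc]

lemma twistMap_mul_comulRight (X : H ⊗[k] (H ⊗[k] H)) (a c : H) :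
    q.twistMap (X * q.comulRight (a ⊗ₜ c)) =
      q.counit c • (q.comul (q.S a) * q.twistMap X) := by
  induction X using tensor3_induction with
  | zero => simp
  | add a b ha hb => simp only [mul_add, add_mul, map_add, ha, hb, smul_add]
  | tmul x y z =>
    have key : ∀ t : H ⊗[k] H, q.twistMap (x ⊗ₜ (y ⊗ₜ z) * a ⊗ₜ t) =
          q.comul (q.S a * (q.S x * q.alpha * y)) * q.conjB t * q.sswap (q.comul z) := by
      intro t
      induction t with
      | zero => simp
      | add s t hs ht => simp only [TensorProduct.tmul_add, map_add, mul_add, add_mul, hs, ht]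
      | tmul u v => simp [q.S_mul, sswap_mul, mul_assoc]
    rw [comulRight_tmul, key, conjB_comul]
    simp [mul_assoc]

/-- `Δ(S(h)) f⁻¹ = f⁻¹ (S ⊗ S)(Δ^cop h)`. -/
lemma comul_S_mul_twistInv (h : H) :
    q.comul (q.S h) * q.twistInv = q.twistInv * q.sswap (q.comul h) := by
  have e := congrArg q.twistMap (q.PhiInv_mul_comulRight_comul h)
  rw [twistInv_eq]
  conv_lhs => rw [← q.counit_right h]
  conv_rhs => rw [← q.counit_left h]
  rw [q.comul_eq h] at e
  simpa only [map_sum, map_smul, Finset.mul_sum, Finset.sum_mul, twistMap_comulLeft_mul,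
    twistMap_mul_comulRight, smul_mul_assoc, mul_smul_comm] using e

lemma Sinv_mul (x y : H) : q.Sinv (x * y) = q.Sinv y * q.Sinv x := by
  rw [← q.Sinv_S (q.Sinv y * q.Sinv x), q.S_mul, q.S_Sinv, q.S_Sinv]

/-- `ε ⊗ id : H ⊗ H → H`. -/
def counitLeft : H ⊗[k] H →ₐ[k] H :=
  (Algebra.TensorProduct.lid k H).toAlgHom.comp
    (Algebra.TensorProduct.map q.counit (AlgHom.id k H))

/-- `id ⊗ ε : H ⊗ H → H`. -/
def counitRight : H ⊗[k] H →ₐ[k] H :=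
  (Algebra.TensorProduct.rid k k H).toAlgHom.comp
    (Algebra.TensorProduct.map (AlgHom.id k H) q.counit)

@[simp] lemma counitLeft_tmul (x y : H) : q.counitLeft (x ⊗ₜ y) = q.counit x • y := rfl

@[simp] lemma counitRight_tmul (x y : H) : q.counitRight (x ⊗ₜ y) = q.counit y • x := rfl

@[simp] lemma counitLeft_comul (h : H) : q.counitLeft (q.comul h) = h := by
  conv_rhs => rw [← q.counit_left h]
  rw [q.comul_eq]; simp

@[simp] lemma counitRight_comul (h : H) : q.counitRight (q.comul h) = h := by
  conv_rhs => rw [← q.counit_right h]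
  rw [q.comul_eq]; simp

/-- `id ⊗ ε ⊗ id : H^{⊗3} → H^{⊗2}`. -/
def counitSnd : H ⊗[k] (H ⊗[k] H) →ₐ[k] H ⊗[k] H :=
  Algebra.TensorProduct.map (AlgHom.id k H) q.counitLeft

/-- `id ⊗ id ⊗ ε : H^{⊗3} → H^{⊗2}`. -/
def counitTrd : H ⊗[k] (H ⊗[k] H) →ₐ[k] H ⊗[k] H :=
  Algebra.TensorProduct.map (AlgHom.id k H) q.counitRight

/-- `id ⊗ id ⊗ ε ⊗ id : H^{⊗4} → H^{⊗3}`. -/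
def counitTrdOfFour : H ⊗[k] (H ⊗[k] (H ⊗[k] H)) →ₐ[k] H ⊗[k] (H ⊗[k] H) :=
  Algebra.TensorProduct.map (AlgHom.id k H) q.counitSnd

@[simp] lemma counitSnd_tmul (x : H) (t : H ⊗[k] H) :
    q.counitSnd (x ⊗ₜ t) = x ⊗ₜ q.counitLeft t := rfl

@[simp] lemma counitTrd_tmul (x : H) (t : H ⊗[k] H) :
    q.counitTrd (x ⊗ₜ t) = x ⊗ₜ q.counitRight t := rfl

@[simp] lemma counitTrdOfFour_tmul (x : H) (t : H ⊗[k] (H ⊗[k] H)) :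
    q.counitTrdOfFour (x ⊗ₜ t) = x ⊗ₜ q.counitSnd t := rfl

lemma counitSnd_Phi : q.counitSnd q.Phi = 1 := by
  rw [Algebra.TensorProduct.one_def, ← q.counit_mid_phi]; simp [Phi]

lemma counitTrdOfFour_comulTrd (X : H ⊗[k] (H ⊗[k] H)) :
    q.counitTrdOfFour (q.comulTrd X) = X := by
  induction X using tensor3_induction with
  | zero => simp
  | add a b ha hb => simp only [map_add, ha, hb]
  | tmul x y z => simp

lemma counitTrdOfFour_comulFst (X : H ⊗[k] (H ⊗[k] H)) :
    q.counitTrdOfFour (q.comulFst X) = q.comulLeft (q.counitSnd X) := by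
  induction X using tensor3_induction with
  | zero => simp
  | add a b ha hb => simp only [map_add, ha, hb]
  | tmul x y z =>
    simp only [comulFst_tmul, counitSnd_tmul, comulLeft_tmul]
    generalize q.comul x = t
    induction t with
    | zero => simp
    | add s t hs ht => simp only [map_add, TensorProduct.add_tmul, hs, ht]
    | tmul a b => simp

lemma counitTrdOfFour_comulSnd (X : H ⊗[k] (H ⊗[k] H)) :
    q.counitTrdOfFour (q.comulSnd X) = X := by
  induction X using tensor3_induction with
  | zero => simp
  | add a b ha hb => simp only [map_add, ha, hb]
  | tmul x y z =>
    have key : ∀ t : H ⊗[k] H,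
        q.counitSnd (Algebra.TensorProduct.assoc k k k H H H (t ⊗ₜ z)) =
          q.counitRight t ⊗ₜ z := by
      intro t
      induction t with
      | zero => simp
      | add s t hs ht => simp only [map_add, TensorProduct.add_tmul, hs, ht]
      | tmul a b => simp [TensorProduct.smul_tmul]
    simp [key]

lemma counitTrdOfFour_append (X : H ⊗[k] (H ⊗[k] H)) :
    q.counitTrdOfFour (append (X ⊗ₜ (1 : H))) =
      Algebra.TensorProduct.assoc k k k H H H (q.counitTrd X ⊗ₜ 1) := by
  induction X using tensor3_induction with
  | zero => simp
  | add a b ha hb => simp only [map_add, TensorProduct.add_tmul, ha, hb]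
  | tmul x y z => simp [← TensorProduct.smul_tmul']

lemma counitTrd_assoc (t : H ⊗[k] H) :
    q.counitTrd (Algebra.TensorProduct.assoc k k k H H H (t ⊗ₜ 1)) = t := by
  induction t with
  | zero => simp
  | add s t hs ht => simp only [map_add, TensorProduct.add_tmul, hs, ht]
  | tmul a b => simp

/-- `(id ⊗ id ⊗ ε)(φ) = 1 ⊗ 1`. -/
lemma counitTrd_Phi : q.counitTrd q.Phi = 1 := by
  have e := congrArg q.counitTrdOfFour q.pentagon_Phi
  rw [map_mul, map_mul, map_mul, counitTrdOfFour_comulTrd, counitTrdOfFour_comulFst,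
    counitSnd_Phi, map_one, counitTrdOfFour_tmul, counitSnd_Phi,
    ← Algebra.TensorProduct.one_def, one_mul, counitTrdOfFour_comulSnd,
    counitTrdOfFour_append] at e
  have e_cancel := congrArg (fun t => q.counitTrd (q.PhiInv * t)) e
  simp only [← mul_assoc, PhiInv_mul_Phi, one_mul, map_one] at e_cancel
  rw [counitTrd_assoc] at e_cancel
  exact e_cancel.symm

/-- `x ⊗ y ⊗ z ↦ x ⊗ S̄(α z) y`, sending `φ` to `q^R`. -/
def qRMap : H ⊗[k] (H ⊗[k] H) →ₗ[k] H ⊗[k] H :=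
  TensorProduct.map LinearMap.id (TensorProduct.lift
    ((LinearMap.mul k H).comp (q.Sinv.comp (LinearMap.mulLeft k q.alpha))).flip)

/-- `x ⊗ y ⊗ z ⊗ w ↦ x ⊗ y ⊗ S̄(α w) z`. -/
def qRMapTail : H ⊗[k] (H ⊗[k] (H ⊗[k] H)) →ₗ[k] H ⊗[k] (H ⊗[k] H) :=
  TensorProduct.map LinearMap.id q.qRMap

@[simp] lemma qRMap_tmul (x y z : H) :
    q.qRMap (x ⊗ₜ (y ⊗ₜ z)) = x ⊗ₜ (q.Sinv (q.alpha * z) * y) := rfl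

@[simp] lemma qRMapTail_tmul (x : H) (t : H ⊗[k] (H ⊗[k] H)) :
    q.qRMapTail (x ⊗ₜ t) = x ⊗ₜ q.qRMap t := rfl

lemma qRE_eq : q.qRE = q.qRMap q.Phi := by
  simp [qRE, qR1, qR2, Phi]

lemma qRMapTail_comulTrd_mul (X : H ⊗[k] (H ⊗[k] H)) (Y : H ⊗[k] (H ⊗[k] (H ⊗[k] H))) :
    q.qRMapTail (q.comulTrd X * Y) =
      Algebra.TensorProduct.assoc k k k H H H (q.counitTrd X ⊗ₜ 1) * q.qRMapTail Y := by
  induction X using tensor3_induction with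
  | zero => simp
  | add a b ha hb => simp only [map_add, TensorProduct.add_tmul, add_mul, ha, hb]
  | tmul x y z =>
  induction Y using tensor4_induction with
  | zero => simp
  | add a b ha hb => simp only [map_add, mul_add, ha, hb]
  | tmul a b c d =>
    have key : ∀ t : H ⊗[k] H,
        q.qRMapTail ((x ⊗ₜ (y ⊗ₜ t)) * (a ⊗ₜ (b ⊗ₜ (c ⊗ₜ d)))) =
          (x * a) ⊗ₜ ((y * b) ⊗ₜ (q.Sinv d * q.Sinv (q.mulAlpha t) * c)) := by
      intro t
      induction t with
      | zero => simp
      | add s t hs ht =>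
        simp only [TensorProduct.tmul_add, map_add, mul_add, add_mul, hs, ht]
      | tmul u v => simp [q.Sinv_mul, q.Sinv_S, mul_assoc]
    rw [comulTrd_tmul, comulRight_tmul, key, mulAlpha_comul]
    simp [q.Sinv_mul, ← TensorProduct.smul_tmul', smul_mul_assoc]

lemma qRMapTail_comulFst_mul_append (X Y : H ⊗[k] (H ⊗[k] H)) :
    q.qRMapTail (q.comulFst X * append (Y ⊗ₜ (1 : H))) = q.comulLeft (q.qRMap X) * Y := by
  induction X using tensor3_induction with
  | zero => simp
  | add a b ha hb => simp only [map_add, add_mul, ha, hb]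
  | tmul x y z =>
  induction Y using tensor3_induction with
  | zero => simp
  | add a b ha hb => simp only [map_add, TensorProduct.add_tmul, mul_add, ha, hb]
  | tmul a b c =>
    rw [comulFst_tmul, qRMap_tmul, comulLeft_tmul]
    generalize q.comul x = t
    induction t with
    | zero => simp
    | add s t hs ht => simp only [map_add, TensorProduct.add_tmul, add_mul, hs, ht]
    | tmul u v => simp [mul_assoc]

lemma qRMapTail_one_tmul_mul_comulSnd (Y : H ⊗[k] (H ⊗[k] H)) (x y z : H) :
    q.qRMapTail (((1 : H) ⊗ₜ[k] Y) * q.comulSnd (x ⊗ₜ (y ⊗ₜ z))) =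
      x ⊗ₜ ((1 ⊗ₜ q.Sinv z) * q.qRMap Y * q.comul y) := by
  rw [comulSnd_tmul, comulLeft_tmul, Algebra.TensorProduct.tmul_mul_tmul, one_mul,
    qRMapTail_tmul]
  congr 1
  generalize q.comul y = t
  induction Y using tensor3_induction with
  | zero => simp
  | add a b ha hb => simp only [map_add, mul_add, add_mul, ha, hb]
  | tmul a b c =>
    induction t with
    | zero => simp
    | add s t hs ht => simp only [map_add, TensorProduct.add_tmul, mul_add, hs, ht]
    | tmul u v => simp [q.Sinv_mul, mul_assoc]

/-- `(Δ ⊗ id)(q^R) φ⁻¹ = φ1 ⊗ (1 ⊗ S̄(φ3)) q^R Δ(φ2)`. -/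
lemma comulLeft_qRE_mul_PhiInv :
    q.comulLeft q.qRE * q.PhiInv = ∑ a ∈ Finset.range q.np,
      q.P1 a ⊗ₜ[k] ((1 ⊗ₜ q.Sinv (q.P3 a)) * q.qRE * q.comul (q.P2 a)) := by
  have h1 : append (q.Phi ⊗ₜ[k] (1 : H)) * append (q.PhiInv ⊗ₜ (1 : H)) = 1 := by
    rw [← map_mul, Algebra.TensorProduct.tmul_mul_tmul, Phi_mul_PhiInv, one_mul]
    rfl
  have h2 := q.qRMapTail_comulTrd_mul q.Phi (q.comulFst q.Phi * append (q.PhiInv ⊗ₜ (1 : H)))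
  rw [counitTrd_Phi, ← Algebra.TensorProduct.one_def, map_one, one_mul, ← mul_assoc,
    pentagon_Phi, mul_assoc _ (append _), h1, mul_one, qRMapTail_comulFst_mul_append] at h2
  rw [qRE_eq, ← h2]
  conv_lhs => rw [show q.comulSnd q.Phi = ∑ a ∈ Finset.range q.np,
    q.comulSnd (q.P1 a ⊗ₜ (q.P2 a ⊗ₜ q.P3 a)) from map_sum _ _ _]
  rw [Finset.mul_sum, map_sum]
  exact Finset.sum_congr rfl fun a _ => q.qRMapTail_one_tmul_mul_comulSnd _ _ _ _

/-- `μ ⊗ id ⊗ id : H^{⊗3} → H^{⊗2}`. -/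
def evalFst (mu : H →ₐ[k] k) : H ⊗[k] (H ⊗[k] H) →ₐ[k] H ⊗[k] H :=
  (Algebra.TensorProduct.lid k (H ⊗[k] H)).toAlgHom.comp
    (Algebra.TensorProduct.map mu (AlgHom.id k (H ⊗[k] H)))

@[simp] lemma evalFst_tmul (mu : H →ₐ[k] k) (x : H) (t : H ⊗[k] H) :
    evalFst mu (x ⊗ₜ t) = mu x • t := rfl

lemma map_lhook_eq (mu : H →ₐ[k] k) (t : H ⊗[k] H) :
    TensorProduct.map (q.lhook mu) LinearMap.id t = evalFst mu (q.comulLeft t) := by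
  induction t with
  | zero => simp
  | add s t hs ht => simp only [map_add, hs, ht]
  | tmul x y =>
    simp only [TensorProduct.map_tmul, lhook, LinearMap.comp_apply, comulLeft_tmul,
      AlgHom.toLinearMap_apply]
    generalize q.comul x = t
    induction t with
    | zero => simp
    | add s t hs ht => simp only [map_add, TensorProduct.add_tmul, hs, ht]
    | tmul u v => simp [TensorProduct.smul_tmul']

lemma WL_eq (mu : H →ₐ[k] k) :
    q.WL mu = q.twistInv * q.sswap (evalFst mu (q.comulLeft q.qRE * q.PhiInv)) := by
  have e : evalFst mu q.PhiInv =
      ∑ b ∈ Finset.range q.nq, mu (q.Q1 b) • (q.Q2 b ⊗ₜ[k] q.Q3 b) := by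
    simp [PhiInv]
  rw [WL, map_lhook_eq, ← e, ← map_mul (evalFst mu)]

lemma sswap_one_tmul_Sinv_mul_mul (z : H) (s t : H ⊗[k] H) :
    q.sswap ((1 ⊗ₜ q.Sinv z) * s * t) = q.sswap t * q.sswap s * (z ⊗ₜ 1) := by
  simp [sswap_mul, q.S_Sinv, q.S_one, mul_assoc]

lemma WL_eq_sum_UL (mu : H →ₐ[k] k) :
    q.WL mu = ∑ a ∈ Finset.range q.np,
      mu (q.P1 a) • (q.comul (q.S (q.P2 a)) * q.UL * (q.P3 a ⊗ₜ[k] (1 : H))) := by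
  rw [WL_eq, comulLeft_qRE_mul_PhiInv]
  simp only [map_sum, evalFst_tmul, map_smul, Finset.mul_sum, mul_smul_comm,
    sswap_one_tmul_Sinv_mul_mul, UL]
  refine Finset.sum_congr rfl fun a _ => ?_
  rw [← mul_assoc (q.comul _), comul_S_mul_twistInv]
  simp only [mul_assoc]

/-- `x ⊗ y ⊗ z ↦ μ(x) Δ(S(y)) T (z ⊗ 1)`. -/
def sandwich (mu : H →ₐ[k] k) (T : H ⊗[k] H) : H ⊗[k] (H ⊗[k] H) →ₗ[k] H ⊗[k] H :=
  (TensorProduct.lift (((LinearMap.mul k (H ⊗[k] H)).comp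
    ((LinearMap.mulRight k T).comp (q.comul.toLinearMap.comp q.S))).compl₂
      (Algebra.TensorProduct.includeLeft : H →ₐ[k] H ⊗[k] H).toLinearMap)).comp
    (evalFst mu).toLinearMap

@[simp] lemma sandwich_tmul (mu : H →ₐ[k] k) (T : H ⊗[k] H) (x y z : H) :
    q.sandwich mu T (x ⊗ₜ (y ⊗ₜ z)) = mu x • (q.comul (q.S y) * T * (z ⊗ₜ 1)) := by
  simp [sandwich]

lemma sandwich_sandwich (mu : H →ₐ[k] k) (T : H ⊗[k] H) (X Y : H ⊗[k] (H ⊗[k] H)) :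
    q.sandwich mu (q.sandwich mu T X) Y = q.sandwich mu T (X * Y) := by
  induction Y using tensor3_induction with
  | zero => simp
  | add a b ha hb => simp only [map_add, mul_add, ha, hb]
  | tmul a b c =>
  rw [sandwich_tmul]
  induction X using tensor3_induction with
  | zero => simp
  | add a b ha hb => simp only [map_add, mul_add, add_mul, smul_add, ha, hb]
  | tmul x y z => simp [q.S_mul, mul_assoc, smul_smul, mul_comm (mu a)]

lemma WL_eq_sandwich (mu : H →ₐ[k] k) : q.WL mu = q.sandwich mu q.UL q.Phi := by
  simp [WL_eq_sum_UL, Phi]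

lemma sandwich_one (mu : H →ₐ[k] k) (T : H ⊗[k] H) : q.sandwich mu T 1 = T := by
  rw [Algebra.TensorProduct.one_def, Algebra.TensorProduct.one_def, sandwich_tmul]
  simp [q.S_one, ← Algebra.TensorProduct.one_def]

end QuasiHopf

/-- `W^L = μ(φ1) S(φ2)₍₁₎ U^L_1 φ3 ⊗ S(φ2)₍₂₎ U^L_2` and
`U^L = μ(φ̄1) S(φ̄2)₍₁₎ W^L_1 φ̄3 ⊗ S(φ̄2)₍₂₎ W^L_2`. -/
theorem statement8 (k H : Type) [Field k] [Ring H] [Algebra k H] (q : QuasiHopf k H)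
    (mu : H →ₐ[k] k) :
    (q.WL mu = ∑ a ∈ Finset.range q.np,
        mu (q.P1 a) • (q.comul (q.S (q.P2 a)) * q.UL * (q.P3 a ⊗ₜ[k] (1 : H)))) ∧
    (q.UL = ∑ b ∈ Finset.range q.nq,
        mu (q.Q1 b) • (q.comul (q.S (q.Q2 b)) * q.WL mu * (q.Q3 b ⊗ₜ[k] (1 : H)))) := by
  refine ⟨q.WL_eq_sum_UL mu, ?_⟩
  have e := q.sandwich_sandwich mu q.UL q.Phi q.PhiInv
  rw [q.Phi_mul_PhiInv, q.sandwich_one, ← q.WL_eq_sandwich] at e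
  rw [← e]
  simp [QuasiHopf.PhiInv]
end
end

section
/- Let H be a quasi-Hopf algebra over a field k with bijective antipode S (inverse S̄), and let Λ ∈ H be a left integral, i.e. hΛ = ε(h)Λ for all h ∈ H. Set Λ̃ = q^R_1 Λ_(1) p^R_1 ⊗ q^R_2 Λ_(2) p^R_2 ∈ H⊗H. Then for all h ∈ H, h·Λ̃_1 ⊗ Λ̃_2 = Λ̃_1 ⊗ S̄(h)·Λ̃_2, i.e. (h⊗1)Λ̃ = (1⊗S̄(h))Λ̃. -/
open scoped TensorProduct

noncomputable section

namespace QuasiHopf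

variable {k H : Type} [Field k] [Ring H] [Algebra k H] (q : QuasiHopf k H)

/-- `x ⊗ y ⊗ z ↦ x ⊗ S̄(α z) y`, the linear map sending `φ` to `q^R`. -/
def contractAlpha : H ⊗[k] (H ⊗[k] H) →ₗ[k] H ⊗[k] H :=
  TensorProduct.map LinearMap.id
    ((LinearMap.mul' k H).comp
      ((TensorProduct.map (q.Sinv.comp (LinearMap.mulLeft k q.alpha)) LinearMap.id).comp
        (TensorProduct.comm k H H).toLinearMap))

@[simp]
lemma contractAlpha_tmul (x y z : H) :
    q.contractAlpha (x ⊗ₜ[k] (y ⊗ₜ[k] z)) = x ⊗ₜ[k] (q.Sinv (q.alpha * z) * y) := by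
  simp [contractAlpha]

lemma contractAlpha_Phi : q.contractAlpha q.Phi = q.qRE := by
  simp [Phi, qRE, qR1, qR2]

lemma contractAlpha_comul_mul (a b : H) (X : H ⊗[k] (H ⊗[k] H)) :
    q.contractAlpha ((a ⊗ₜ[k] q.comul b) * X) =
      ((q.counit b • a) ⊗ₜ[k] (1 : H)) * q.contractAlpha X := by
  induction X with
  | zero => simp
  | add X Y hX hY => simp only [mul_add, map_add, hX, hY]
  | tmul x w =>
    induction w with
    | zero => simp
    | add v w hv hw => simp only [TensorProduct.tmul_add, mul_add, map_add, hv, hw]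
    | tmul y z =>
      have key : ∑ i ∈ Finset.range (q.n b), q.Sinv (q.alpha * (q.d2 b i * z)) * (q.d1 b i * y) =
          q.counit b • (q.Sinv (q.alpha * z) * y) := by
        have h := congrArg (fun t => q.Sinv (t * z) * y) (q.antipode_alpha b)
        simpa [Finset.sum_mul, Sinv_mul, Sinv_S, mul_assoc] using h
      simp only [q.comul_eq b, TensorProduct.tmul_sum, Finset.sum_mul, map_sum,
        Algebra.TensorProduct.tmul_mul_tmul, contractAlpha_tmul, one_mul]
      rw [← TensorProduct.tmul_sum, key, smul_mul_assoc, TensorProduct.tmul_smul,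
        TensorProduct.smul_tmul']

lemma contractAlpha_mul_assoc (X : H ⊗[k] (H ⊗[k] H)) (w : H ⊗[k] H) (c : H) :
    q.contractAlpha (X * TensorProduct.assoc k H H H (w ⊗ₜ[k] c)) =
      ((1 : H) ⊗ₜ[k] q.Sinv c) * (q.contractAlpha X * w) := by
  induction w with
  | zero => simp
  | add v w hv hw => simp only [TensorProduct.add_tmul, mul_add, map_add, hv, hw]
  | tmul a b =>
    induction X with
    | zero => simp
    | add X Y hX hY => simp only [add_mul, mul_add, map_add, hX, hY]
    | tmul x v =>
      induction v with
      | zero => simp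
      | add v w hv hw => simp only [TensorProduct.tmul_add, add_mul, mul_add, map_add, hv, hw]
      | tmul y z => simp [Sinv_mul, mul_assoc]

/-- `(h ⊗ 1) q^R = (1 ⊗ S̄(h₍₂₎)) q^R Δ(h₍₁₎)` -/
lemma tmul_one_mul_qRE (h : H) :
    (h ⊗ₜ[k] (1 : H)) * q.qRE =
      ∑ i ∈ Finset.range (q.n h),
        ((1 : H) ⊗ₜ[k] q.Sinv (q.d2 h i)) * (q.qRE * q.comul (q.d1 h i)) := by
  have comm : (∑ i ∈ Finset.range (q.n h), q.d1 h i ⊗ₜ[k] q.comul (q.d2 h i)) * q.Phi =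
      q.Phi * ∑ i ∈ Finset.range (q.n h),
        TensorProduct.assoc k H H H (q.comul (q.d1 h i) ⊗ₜ[k] q.d2 h i) := by
    rw [q.qcoassoc h, Phi, mul_assoc, q.phiInv_phi, mul_one]
    simp only [q.comul_eq (q.d1 h _), TensorProduct.sum_tmul, map_sum, TensorProduct.assoc_tmul]
  have key := congrArg q.contractAlpha comm
  simp only [Finset.sum_mul, Finset.mul_sum, map_sum, contractAlpha_comul_mul,
    contractAlpha_mul_assoc, contractAlpha_Phi] at key
  rw [← key, ← Finset.sum_mul, ← TensorProduct.sum_tmul, q.counit_right]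

end QuasiHopf

/-- For a left integral `Λ` and
`Λ̃ = q^R_1 Λ₍₁₎ p^R_1 ⊗ q^R_2 Λ₍₂₎ p^R_2` one has `(h ⊗ 1) Λ̃ = (1 ⊗ S̄(h)) Λ̃`. -/
theorem statement11 (k H : Type) [Field k] [Ring H] [Algebra k H] (q : QuasiHopf k H)
    (Lam : H) (hint : ∀ h : H, h * Lam = q.counit h • Lam) :
    ∀ h : H, (h ⊗ₜ[k] (1 : H)) * (q.qRE * q.comul Lam * q.pRE) =
      ((1 : H) ⊗ₜ[k] q.Sinv h) * (q.qRE * q.comul Lam * q.pRE) := by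
  intro h
  rw [← mul_assoc, ← mul_assoc, ← mul_assoc, q.tmul_one_mul_qRE h, ← mul_assoc]
  congr 1
  simp only [Finset.sum_mul, mul_assoc]
  simp only [← map_mul, hint, map_smul, mul_smul_comm]
  simp only [← smul_mul_assoc, ← TensorProduct.tmul_smul, ← map_smul]
  rw [← Finset.sum_mul, ← TensorProduct.tmul_sum, ← map_sum, q.counit_left]
end
end
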